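/- The augmented k-algebra A = F/(r₁, r₂, r₃, r₄) is residually nilpotent: ⋂_{n≥1} I(A)ⁿ = 0. -/

import Mathlib

noncomputable section

/-- The augmentation ideal of an augmented `k`-algebra, as a `k`-submodule. -/
def augIdeal {k A : Type*} [CommRing k] [Ring A] [Algebra k A] (ε : A →ₐ[k] k) :
    Submodule k A :=
  LinearMap.ker ε.toLinearMap

variable (k : Type*) [CommRing k]

/-- The generators `x₁, x₂, y₁, y₂` of the free algebra `F` on four generators:
`x₁ = Xg k 0`, `x₂ = Xg k 1`, `y₁ = Xg k 2`, `y₂ = Xg k 3`. -/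
def Xg (i : Fin 4) : FreeAlgebra k (Fin 4) := FreeAlgebra.ι k i

/-- `r₁ = x₁x₂ + y₁² − y₁`. -/
def r1 : FreeAlgebra k (Fin 4) := Xg k 0 * Xg k 1 + Xg k 2 * Xg k 2 - Xg k 2
/-- `r₂ = x₂x₁ + y₂² − y₂`. -/
def r2 : FreeAlgebra k (Fin 4) := Xg k 1 * Xg k 0 + Xg k 3 * Xg k 3 - Xg k 3
/-- `r₃ = x₁y₂ − y₁x₁`. -/
def r3 : FreeAlgebra k (Fin 4) := Xg k 0 * Xg k 3 - Xg k 2 * Xg k 0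
/-- `r₄ = x₂y₁ − y₂x₂`. -/
def r4 : FreeAlgebra k (Fin 4) := Xg k 1 * Xg k 2 - Xg k 3 * Xg k 1

/-- The relations of `B = F/(r₁, r₂)`. -/
def relB : FreeAlgebra k (Fin 4) → FreeAlgebra k (Fin 4) → Prop := fun a b =>
  (a = r1 k ∨ a = r2 k) ∧ b = 0

/-- The relations of `A = F/(r₁, r₂, r₃, r₄)`. -/
def relA : FreeAlgebra k (Fin 4) → FreeAlgebra k (Fin 4) → Prop := fun a b =>
  (a = r1 k ∨ a = r2 k ∨ a = r3 k ∨ a = r4 k) ∧ b = 0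

/-- `B = F/(r₁, r₂)`. -/
def AlgB : Type _ := RingQuot (relB k)
/-- `A = F/(r₁, r₂, r₃, r₄)`. -/
def AlgA : Type _ := RingQuot (relA k)

instance : Ring (AlgB k) := by unfold AlgB; infer_instance
instance : Algebra k (AlgB k) := by unfold AlgB; infer_instance
instance : Ring (AlgA k) := by unfold AlgA; infer_instance
instance : Algebra k (AlgA k) := by unfold AlgA; infer_instance

/-- The projection `F → B`. -/
def mkB : FreeAlgebra k (Fin 4) →ₐ[k] AlgB k := RingQuot.mkAlgHom k (relB k)
/-- The projection `F → A`. -/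
def mkA : FreeAlgebra k (Fin 4) →ₐ[k] AlgA k := RingQuot.mkAlgHom k (relA k)

/-- The augmentation of `B`, sending every generator to `0`. -/
def εB : AlgB k →ₐ[k] k :=
  RingQuot.liftAlgHom k
    ⟨FreeAlgebra.lift k (fun _ => (0 : k)), by
      rintro a b ⟨h, rfl⟩
      rcases h with rfl | rfl <;> simp [r1, r2, Xg]⟩

/-- The augmentation of `A`, sending every generator to `0`. -/
def εA : AlgA k →ₐ[k] k :=
  RingQuot.liftAlgHom k
    ⟨FreeAlgebra.lift k (fun _ => (0 : k)), by
      rintro a b ⟨h, rfl⟩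
      rcases h with rfl | rfl | rfl | rfl <;> simp [r1, r2, r3, r4, Xg]⟩

lemma mkA_surjective : Function.Surjective (mkA k) :=
  RingQuot.mkAlgHom_surjective k (relA k)

lemma mkA_eq_zero {r : FreeAlgebra k (Fin 4)}
    (hr : r = r1 k ∨ r = r2 k ∨ r = r3 k ∨ r = r4 k) : mkA k r = 0 := by
  have h : mkA k r = mkA k 0 := RingQuot.mkAlgHom_rel k (s := relA k) ⟨hr, rfl⟩
  rw [h, map_zero]

lemma εA_mkA (f : FreeAlgebra k (Fin 4)) :
    εA k (mkA k f) = FreeAlgebra.lift k (fun _ => (0 : k)) f :=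
  RingQuot.liftAlgHom_mkAlgHom_apply k _ _ f

/-- The image in `A` of the `i`-th generator. -/
def genA (i : Fin 4) : AlgA k := mkA k (Xg k i)

lemma genA_zero_mul_one : genA k 0 * genA k 1 = genA k 2 - genA k 2 * genA k 2 := by
  have h := mkA_eq_zero k (r := r1 k) (by simp)
  simp only [r1, map_sub, map_add, map_mul] at h
  exact eq_sub_of_add_eq (sub_eq_zero.mp h)

lemma genA_one_mul_zero : genA k 1 * genA k 0 = genA k 3 - genA k 3 * genA k 3 := by
  have h := mkA_eq_zero k (r := r2 k) (by simp)
  simp only [r2, map_sub, map_add, map_mul] at h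
  exact eq_sub_of_add_eq (sub_eq_zero.mp h)

lemma genA_zero_mul_three : genA k 0 * genA k 3 = genA k 2 * genA k 0 := by
  have h := mkA_eq_zero k (r := r3 k) (by simp)
  simp only [r3, map_sub, map_mul] at h
  exact sub_eq_zero.mp h

lemma genA_one_mul_two : genA k 1 * genA k 2 = genA k 3 * genA k 1 := by
  have h := mkA_eq_zero k (r := r4 k) (by simp)
  simp only [r4, map_sub, map_mul] at h
  exact sub_eq_zero.mp h

/-- The free algebra `k⟨a, b⟩`, realised as the monoid algebra of words in `a = false` and
`b = true`. -/
abbrev WordAlg : Type _ := MonoidAlgebra k (FreeMonoid Bool)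

/-- The monomial of `k⟨a, b⟩` given by a word. -/
def monom (w : List Bool) : WordAlg k := MonoidAlgebra.of k (FreeMonoid Bool) (FreeMonoid.ofList w)

lemma monom_append (v w : List Bool) : monom k (v ++ w) = monom k v * monom k w := by
  simp only [monom, FreeMonoid.ofList_append, map_mul]

lemma monom_nil : monom k [] = 1 := map_one (MonoidAlgebra.of k (FreeMonoid Bool))

/-- The images `a - aba`, `b`, `ab`, `ba` in `k⟨a, b⟩` of the generators of `A`. -/
def genImage : Fin 4 → WordAlg k :=
  ![monom k [false] - monom k [false, true, false], monom k [true],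
    monom k [false, true], monom k [true, false]]

/-- The homomorphism `A → k⟨a, b⟩` with `x₁ ↦ a - aba`, `x₂ ↦ b`, `y₁ ↦ ab`, `y₂ ↦ ba`. -/
def toWordAlg : AlgA k →ₐ[k] WordAlg k :=
  RingQuot.liftAlgHom k ⟨FreeAlgebra.lift k (genImage k), by
    rintro a b ⟨h, rfl⟩
    rcases h with rfl | rfl | rfl | rfl <;>
      simp [r1, r2, r3, r4, Xg, genImage, sub_mul, mul_sub, ← monom_append]⟩

lemma toWordAlg_mkA (f : FreeAlgebra k (Fin 4)) :
    toWordAlg k (mkA k f) = FreeAlgebra.lift k (genImage k) f :=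
  RingQuot.liftAlgHom_mkAlgHom_apply k _ _ f

lemma toWordAlg_genA (i : Fin 4) : toWordAlg k (genA k i) = genImage k i := by
  rw [genA, toWordAlg_mkA, Xg, FreeAlgebra.lift_ι_apply]

/-- The span of the words of length at least `n` in `k⟨a, b⟩`. -/
def wordFiltration (n : ℕ) : Submodule k (WordAlg k) :=
  Submodule.span k (monom k '' {w | n ≤ w.length})

variable {k}

lemma monom_mem_wordFiltration {n : ℕ} {w : List Bool} (h : n ≤ w.length) :
    monom k w ∈ wordFiltration k n :=
  Submodule.subset_span ⟨w, h, rfl⟩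

lemma wordFiltration_anti {m n : ℕ} (h : m ≤ n) : wordFiltration k n ≤ wordFiltration k m :=
  Submodule.span_mono (Set.image_mono fun _ hw => h.trans hw)

lemma wordFiltration_mul_le (m n : ℕ) :
    wordFiltration k m * wordFiltration k n ≤ wordFiltration k (m + n) := by
  rw [wordFiltration, wordFiltration, Submodule.span_mul_span, Submodule.span_le]
  rintro _ ⟨_, ⟨v, hv, rfl⟩, _, ⟨w, hw, rfl⟩, rfl⟩
  simp only [← monom_append]
  refine monom_mem_wordFiltration ?_
  rw [List.length_append]
  exact Nat.add_le_add hv hw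

lemma mul_mem_wordFiltration {m n : ℕ} {p q : WordAlg k} (hp : p ∈ wordFiltration k m)
    (hq : q ∈ wordFiltration k n) : p * q ∈ wordFiltration k (m + n) :=
  wordFiltration_mul_le m n (Submodule.mul_mem_mul hp hq)

lemma mem_wordFiltration_zero (p : WordAlg k) : p ∈ wordFiltration k 0 := by
  induction p using MonoidAlgebra.induction_on with
  | of w => exact monom_mem_wordFiltration (w := w.toList) (Nat.zero_le _)
  | add p q hp hq => exact add_mem hp hq
  | smul r p hp => exact Submodule.smul_mem _ r hp

/-- The coefficient of a word, as a linear functional on `k⟨a, b⟩`. -/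
def wordCoeff (w : List Bool) : WordAlg k →ₗ[k] k :=
  (Finsupp.lapply (FreeMonoid.ofList w)) ∘ₗ (MonoidAlgebra.coeffLinearEquiv k).toLinearMap

lemma wordCoeff_monom (v w : List Bool) :
    wordCoeff w (monom k v) = if v = w then 1 else 0 := by
  classical
  have h : wordCoeff w (monom k v) =
      Finsupp.single (FreeMonoid.ofList v) (1 : k) (FreeMonoid.ofList w) := rfl
  rw [h, Finsupp.single_apply]
  simp only [EmbeddingLike.apply_eq_iff_eq]

lemma wordCoeff_eq_zero {n : ℕ} {p : WordAlg k} (hp : p ∈ wordFiltration k n) {w : List Bool}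
    (hw : w.length < n) : wordCoeff w p = 0 := by
  have h : wordFiltration k n ≤ LinearMap.ker (wordCoeff (k := k) w) := by
    rw [wordFiltration, Submodule.span_le]
    rintro _ ⟨v, hv, rfl⟩
    have hvw : v ≠ w := by
      rintro rfl
      exact absurd hv (not_le.mpr hw)
    simp [wordCoeff_monom, hvw]
  exact h hp

lemma genImage_mem (i : Fin 4) : genImage k i ∈ wordFiltration k 1 := by
  fin_cases i
  · exact sub_mem (monom_mem_wordFiltration (by simp)) (monom_mem_wordFiltration (by simp))
  all_goals exact monom_mem_wordFiltration (by simp)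

lemma toWordAlg_sub_algebraMap_mem (f : AlgA k) :
    toWordAlg k f - algebraMap k _ (εA k f) ∈ wordFiltration k 1 := by
  obtain ⟨f, rfl⟩ := mkA_surjective k f
  rw [toWordAlg_mkA, εA_mkA]
  induction f using FreeAlgebra.induction with
  | grade0 r => simp
  | grade1 i => simpa using genImage_mem i
  | add f g hf hg =>
    simp only [map_add]
    rw [add_sub_add_comm]
    exact add_mem hf hg
  | mul f g hf hg =>
    have h := add_mem
      (mul_mem_wordFiltration hf (mem_wordFiltration_zero (FreeAlgebra.lift k (genImage k) g)))
      (Submodule.smul_mem _ (FreeAlgebra.lift k (fun _ => (0 : k)) f) hg)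
    convert h using 1
    simp only [map_mul, Algebra.smul_def]
    noncomm_ring

lemma toWordAlg_mem_of_mem_pow (n : ℕ) {f : AlgA k} (hf : f ∈ augIdeal (εA k) ^ n) :
    toWordAlg k f ∈ wordFiltration k n := by
  induction n generalizing f with
  | zero => exact mem_wordFiltration_zero _
  | succ n ih =>
    rw [pow_succ] at hf
    induction hf using Submodule.mul_induction_on' with
    | mem_mul_mem p hp q hq =>
      rw [map_mul]
      refine mul_mem_wordFiltration (ih hp) ?_
      have h := toWordAlg_sub_algebraMap_mem q
      rwa [show εA k q = 0 from hq, map_zero, sub_zero] at h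
    | add p _ q _ hp hq =>
      rw [map_add]
      exact add_mem hp hq

variable (k)

/-- The normal form in `A` whose image in `k⟨a, b⟩` has the given word as lowest term. -/
def normalWord : List Bool → AlgA k
  | [] => 1
  | [false] => genA k 0
  | [true] => genA k 1
  | false :: false :: w => genA k 0 * normalWord (false :: w)
  | false :: true :: w => genA k 2 * normalWord w
  | true :: true :: w => genA k 1 * normalWord (true :: w)
  | true :: false :: w => genA k 3 * normalWord w

/-- The span of the normal forms. -/
def normalSpan : Submodule k (AlgA k) := Submodule.span k (Set.range (normalWord k))

variable {k}

lemma normalWord_mem (w : List Bool) : normalWord k w ∈ normalSpan k :=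
  Submodule.subset_span ⟨w, rfl⟩

lemma mul_mem_of_mem_span {R B : Type*} [CommSemiring R] [Semiring B] [Algebra R B] {s : Set B}
    {T : Submodule R B} {g : B} (h : ∀ b ∈ s, g * b ∈ T) {b : B} (hb : b ∈ Submodule.span R s) :
    g * b ∈ T :=
  (Submodule.span_le (p := T.comap (LinearMap.mulLeft R g))).mpr h hb

lemma mul_mem_normalSpan {g : AlgA k} (h : ∀ w, g * normalWord k w ∈ normalSpan k) {f : AlgA k}
    (hf : f ∈ normalSpan k) : g * f ∈ normalSpan k :=
  mul_mem_of_mem_span (Set.forall_mem_range.mpr h) hf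

lemma genA_two_mul_mem {f : AlgA k} (hf : f ∈ normalSpan k) : genA k 2 * f ∈ normalSpan k :=
  mul_mem_normalSpan (fun w => by
    simpa only [normalWord] using normalWord_mem (k := k) (false :: true :: w)) hf

lemma genA_three_mul_mem {f : AlgA k} (hf : f ∈ normalSpan k) : genA k 3 * f ∈ normalSpan k :=
  mul_mem_normalSpan (fun w => by
    simpa only [normalWord] using normalWord_mem (k := k) (true :: false :: w)) hf

lemma genA_zero_mul_normalWord_mem : ∀ w, genA k 0 * normalWord k w ∈ normalSpan k
  | [] => by simpa only [normalWord, mul_one] using normalWord_mem (k := k) [false]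
  | false :: w => by simpa only [normalWord] using normalWord_mem (k := k) (false :: false :: w)
  | [true] => by
    have h : genA k 2 ∈ normalSpan k := by
      simpa only [normalWord, mul_one] using normalWord_mem (k := k) [false, true]
    rw [normalWord, genA_zero_mul_one]
    exact Submodule.sub_mem _ h (genA_two_mul_mem h)
  | true :: true :: w => by
    have h := genA_two_mul_mem (normalWord_mem (k := k) (true :: w))
    rw [normalWord, ← mul_assoc, genA_zero_mul_one, sub_mul, mul_assoc]
    exact Submodule.sub_mem _ h (genA_two_mul_mem h)
  | true :: false :: w => by
    rw [normalWord, ← mul_assoc, genA_zero_mul_three, mul_assoc]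
    exact genA_two_mul_mem (genA_zero_mul_normalWord_mem w)

lemma genA_one_mul_normalWord_mem : ∀ w, genA k 1 * normalWord k w ∈ normalSpan k
  | [] => by simpa only [normalWord, mul_one] using normalWord_mem (k := k) [true]
  | true :: w => by simpa only [normalWord] using normalWord_mem (k := k) (true :: true :: w)
  | [false] => by
    have h : genA k 3 ∈ normalSpan k := by
      simpa only [normalWord, mul_one] using normalWord_mem (k := k) [true, false]
    rw [normalWord, genA_one_mul_zero]
    exact Submodule.sub_mem _ h (genA_three_mul_mem h)
  | false :: false :: w => by
    have h := genA_three_mul_mem (normalWord_mem (k := k) (false :: w))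
    rw [normalWord, ← mul_assoc, genA_one_mul_zero, sub_mul, mul_assoc]
    exact Submodule.sub_mem _ h (genA_three_mul_mem h)
  | false :: true :: w => by
    rw [normalWord, ← mul_assoc, genA_one_mul_two, mul_assoc]
    exact genA_three_mul_mem (genA_one_mul_normalWord_mem w)

lemma mkA_mul_mem_normalSpan (f : FreeAlgebra k (Fin 4)) :
    ∀ g ∈ normalSpan k, mkA k f * g ∈ normalSpan k := by
  induction f using FreeAlgebra.induction with
  | grade0 r =>
    intro g hg
    rw [AlgHom.commutes, ← Algebra.smul_def]
    exact Submodule.smul_mem _ r hg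
  | grade1 i =>
    intro g hg
    change genA k i * g ∈ normalSpan k
    fin_cases i
    · exact mul_mem_normalSpan genA_zero_mul_normalWord_mem hg
    · exact mul_mem_normalSpan genA_one_mul_normalWord_mem hg
    · exact genA_two_mul_mem hg
    · exact genA_three_mul_mem hg
  | add p q hp hq =>
    intro g hg
    rw [map_add, add_mul]
    exact add_mem (hp g hg) (hq g hg)
  | mul p q hp hq =>
    intro g hg
    rw [map_mul, mul_assoc]
    exact hp _ (hq g hg)

lemma mem_normalSpan (f : AlgA k) : f ∈ normalSpan k := by
  obtain ⟨f, rfl⟩ := mkA_surjective k f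
  simpa using mkA_mul_mem_normalSpan f 1 (normalWord_mem [])

lemma mul_sub_monom_append_mem {p q : WordAlg k} (v w : List Bool)
    (hp : p - monom k v ∈ wordFiltration k (v.length + 1))
    (hq : q - monom k w ∈ wordFiltration k (w.length + 1)) :
    p * q - monom k (v ++ w) ∈ wordFiltration k ((v ++ w).length + 1) := by
  have hq' : q ∈ wordFiltration k w.length := by
    have h := add_mem (wordFiltration_anti (Nat.le_succ _) hq)
      (monom_mem_wordFiltration (k := k) (le_refl w.length))
    rwa [sub_add_cancel] at h
  have h1 := mul_mem_wordFiltration hp hq'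
  have h2 := mul_mem_wordFiltration (monom_mem_wordFiltration (k := k) (le_refl v.length)) hq
  have h := add_mem
    (wordFiltration_anti (m := (v ++ w).length + 1) (by rw [List.length_append]; omega) h1)
    (wordFiltration_anti (m := (v ++ w).length + 1) (by simp [add_assoc]) h2)
  convert h using 1
  rw [monom_append]
  noncomm_ring

/-- The lowest words of the images of the generators of `A`. -/
def lowestWord : Fin 4 → List Bool :=
  ![[false], [true], [false, true], [true, false]]

lemma genImage_sub_monom_mem (i : Fin 4) :
    genImage k i - monom k (lowestWord i) ∈ wordFiltration k ((lowestWord i).length + 1) := by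
  fin_cases i
  · simp only [Fin.zero_eta, genImage, lowestWord, Matrix.cons_val_zero, sub_sub_cancel_left]
    exact neg_mem (monom_mem_wordFiltration (by simp))
  all_goals simp [genImage, lowestWord]

lemma toWordAlg_genA_mul_sub_monom_mem (i : Fin 4) {f : AlgA k} {w : List Bool}
    (hf : toWordAlg k f - monom k w ∈ wordFiltration k (w.length + 1)) :
    toWordAlg k (genA k i * f) - monom k (lowestWord i ++ w) ∈
      wordFiltration k ((lowestWord i ++ w).length + 1) := by
  rw [map_mul, toWordAlg_genA]
  exact mul_sub_monom_append_mem _ _ (genImage_sub_monom_mem i) hf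

lemma toWordAlg_normalWord_sub_monom_mem : ∀ w : List Bool,
    toWordAlg k (normalWord k w) - monom k w ∈ wordFiltration k (w.length + 1)
  | [] => by simp [normalWord, monom_nil]
  | [false] => by
    rw [normalWord, toWordAlg_genA]
    exact genImage_sub_monom_mem 0
  | [true] => by
    rw [normalWord, toWordAlg_genA]
    exact genImage_sub_monom_mem 1
  | false :: false :: w => by
    rw [normalWord]
    exact toWordAlg_genA_mul_sub_monom_mem 0 (toWordAlg_normalWord_sub_monom_mem (false :: w))
  | false :: true :: w => by
    rw [normalWord]
    exact toWordAlg_genA_mul_sub_monom_mem 2 (toWordAlg_normalWord_sub_monom_mem w)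
  | true :: true :: w => by
    rw [normalWord]
    exact toWordAlg_genA_mul_sub_monom_mem 1 (toWordAlg_normalWord_sub_monom_mem (true :: w))
  | true :: false :: w => by
    rw [normalWord]
    exact toWordAlg_genA_mul_sub_monom_mem 3 (toWordAlg_normalWord_sub_monom_mem w)

lemma wordCoeff_toWordAlg_normalWord {v w : List Bool} (h : w.length ≤ v.length) :
    wordCoeff w (toWordAlg k (normalWord k v)) = if v = w then 1 else 0 := by
  have h0 := wordCoeff_eq_zero (toWordAlg_normalWord_sub_monom_mem (k := k) v)
    (Nat.lt_succ_of_le h)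
  rw [map_sub, sub_eq_zero] at h0
  rw [h0, wordCoeff_monom]

lemma eq_zero_of_wordCoeff_eq_zero {f : AlgA k}
    (hf : ∀ w, wordCoeff w (toWordAlg k f) = 0) : f = 0 := by
  obtain ⟨c, rfl⟩ := Finsupp.mem_span_range_iff_exists_finsupp.mp (mem_normalSpan f)
  suffices hc : c = 0 by simp [hc]
  by_contra hc
  obtain ⟨w, hw, hmin⟩ :=
    Finset.exists_min_image c.support List.length (Finsupp.support_nonempty_iff.mpr hc)
  refine Finsupp.mem_support_iff.mp hw ?_
  rw [← hf w, Finsupp.sum, map_sum, map_sum, Finset.sum_eq_single_of_mem w hw]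
  · rw [map_smul, map_smul, wordCoeff_toWordAlg_normalWord le_rfl]
    simp
  · intro v hv hvw
    rw [map_smul, map_smul, wordCoeff_toWordAlg_normalWord (hmin v hv), if_neg hvw, smul_zero]

variable (k)

/-- The augmented algebra `A = k⟨x₁,x₂,y₁,y₂ ∣ r₁,r₂,r₃,r₄⟩` is residually nilpotent:
`⋂_{n≥1} I(A)ⁿ = 0`. -/
theorem algA_residually_nilpotent :
    (⨅ n ∈ {n : ℕ | 1 ≤ n}, augIdeal (εA k) ^ n) = ⊥ := by
  rw [eq_bot_iff]
  intro f hf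
  simp only [Submodule.mem_iInf] at hf
  refine (Submodule.mem_bot k).mpr (eq_zero_of_wordCoeff_eq_zero fun w => ?_)
  exact wordCoeff_eq_zero (toWordAlg_mem_of_mem_pow (w.length + 1) (hf _ (Nat.le_add_left 1 _)))
    (Nat.lt_succ_self _)
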